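/- arXiv:1902.01766 — 5 statements merged into one kernel-verified Lean document; each statement's English description precedes it below -/
import Mathlib

section
/- Assume the compact Arnoldi decomposition L·V_k = V_{k+1}·H̄ holds, where U_{k+1,1} = [[U_{k,1}, x_k],[0, β_k]], U_{k+1,2} = [[U_{k,2}, y_k],[0, 0]], and H̄ has leading k×k block H_k and last row h_{k+1,k}·e_kᵀ. Set r = A·Q_k·U_{k,1}·e_k + B·Q_k·U_{k,2}·e_k (the new second-order Krylov direction). If h_{k+1,k}·β_k ≠ 0, then the column space of Q_{k+1} = [Q_k, q_{k+1}] equals the span of the columns of Q_k together with the vector r. -/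
open Matrix

/-- Replacing a generator `q` by `c • q + v` with `c` invertible and `v` in the span of the
remaining generators does not change the span. -/
theorem Submodule.span_union_singleton_smul_add {K V : Type*} [Field K] [AddCommGroup V]
    [Module K V] {s : Set V} {q v : V} {c : K} (hc : c ≠ 0) (hv : v ∈ span K s) :
    span K (s ∪ {q}) = span K (s ∪ {c • q + v}) := by
  have hs (x : V) : span K s ≤ span K (s ∪ {x}) := span_mono Set.subset_union_left
  have hx (x : V) : x ∈ span K (s ∪ {x}) := subset_span (Or.inr rfl)
  apply le_antisymm <;> rw [span_le, Set.union_subset_iff, Set.singleton_subset_iff]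
  · refine ⟨subset_span.trans (hs _), ?_⟩
    have h := smul_mem _ c⁻¹ (sub_mem (hx (c • q + v)) (hs _ hv))
    rwa [add_sub_cancel_right, inv_smul_smul₀ hc] at h
  · exact ⟨subset_span.trans (hs _), add_mem (smul_mem _ c (hx q)) (hs _ hv)⟩

/-- Under the compact Arnoldi decomposition `L V_k = V_{k+1} H̄` with the
bordered structures `U_{k+1,1} = [[U_{k,1}, x_k],[0, β_k]]`,
`U_{k+1,2} = [[U_{k,2}, y_k],[0, 0]]` and `H̄ = [H_k ; h_{k+1,k} e_kᵀ]`, if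
`h_{k+1,k} β_k ≠ 0` then the column space of `Q_{k+1} = [Q_k, q_{k+1}]` equals the span of
the columns of `Q_k` together with the new second-order Krylov direction
`r = A Q_k U_{k,1} e_k + B Q_k U_{k,2} e_k`.
(The paper's `k` is here `k+1`, so that the last column index is `Fin.last k`.) -/
theorem stmt2 (n m k : ℕ) (A B : Matrix (Fin n) (Fin n) ℂ)
    (Qk : Matrix (Fin n) (Fin m) ℂ) (qk1 : Fin n → ℂ)
    (Uk1 Uk2 : Matrix (Fin m) (Fin (k + 1)) ℂ)
    (xk yk : Fin m → ℂ) (βk hsub : ℂ)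
    (Hk : Matrix (Fin (k + 1)) (Fin (k + 1)) ℂ)
    (Qk1 : Matrix (Fin n) (Fin m ⊕ Unit) ℂ)
    (hQk1 : Qk1 = Matrix.of fun i => Sum.elim (Qk i) fun _ => qk1 i)
    (Uk11 Uk12 : Matrix (Fin m ⊕ Unit) (Fin (k + 1) ⊕ Unit) ℂ)
    (hUk11 : Uk11 = Matrix.fromBlocks Uk1 (Matrix.of fun i (_ : Unit) => xk i) 0
      (Matrix.of fun (_ : Unit) (_ : Unit) => βk))
    (hUk12 : Uk12 = Matrix.fromBlocks Uk2 (Matrix.of fun i (_ : Unit) => yk i) 0 0)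
    (Hb : Matrix (Fin (k + 1) ⊕ Unit) (Fin (k + 1)) ℂ)
    (hHb : Hb = Matrix.fromRows Hk
      (Matrix.of fun (_ : Unit) j => if j = Fin.last k then hsub else 0))
    (hArnoldi :
      Matrix.fromBlocks A B (1 : Matrix (Fin n) (Fin n) ℂ) 0 *
          Matrix.fromRows (Qk * Uk1) (Qk * Uk2)
        = Matrix.fromRows (Qk1 * Uk11) (Qk1 * Uk12) * Hb)
    (hne : hsub * βk ≠ 0)
    (r : Fin n → ℂ)
    (hr : r = fun i =>
      (A * Qk * Uk1) i (Fin.last k) + (B * Qk * Uk2) i (Fin.last k)) :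
    Submodule.span ℂ (Set.range Qk1ᵀ)
      = Submodule.span ℂ (Set.range Qkᵀ ∪ {r}) := by
  have hrange : Set.range Qk1ᵀ = Set.range Qkᵀ ∪ {qk1} := by
    have hT : Qk1ᵀ = Sum.elim Qkᵀ fun _ => qk1 := by
      subst hQk1
      ext (j | j) i <;> rfl
    exact (congrArg Set.range hT).trans (by erw [Set.Sum.elim_range, Set.range_const])
  have hr' : r = (hsub * βk) • qk1 +
      Qk *ᵥ ((Uk1 * Hk).col (Fin.last k) + hsub • xk) := by
    subst hr hQk1 hUk11 hHb
    ext i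
    have h := congrFun (congrFun hArnoldi (Sum.inl i)) (Fin.last k)
    rw [Matrix.fromBlocks_mul_fromRows, Matrix.fromRows_mul, Matrix.fromRows_apply_inl,
      Matrix.fromRows_apply_inl, Matrix.mul_assoc, Matrix.fromBlocks_mul_fromRows] at h
    simp only [Matrix.mul_assoc, Matrix.add_apply] at h ⊢
    rw [h]
    simp [Matrix.mul_apply, Matrix.mulVec, dotProduct, mul_add, Finset.sum_add_distrib,
      Finset.mul_sum]
    simp only [mul_comm hsub, mul_assoc]
    ring
  have hv : Qk *ᵥ ((Uk1 * Hk).col (Fin.last k) + hsub • xk) ∈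
      Submodule.span ℂ (Set.range Qkᵀ) := by
    have h := LinearMap.mem_range_self Qk.mulVecLin ((Uk1 * Hk).col (Fin.last k) + hsub • xk)
    rwa [Matrix.range_mulVecLin] at h
  rw [hrange, hr', Submodule.span_union_singleton_smul_add hne hv]
end

section
/- Assume the compact Arnoldi decomposition L·V_k = V_{k+1}·H̄ holds, where V_{k+1} has orthonormal columns (V_{k+1}ᴴ·V_{k+1} = I), V_k consists of the first k columns of V_{k+1}, and Q_k has orthonormal columns (Q_kᴴ·Q_k = I). Then U_{k,1}ᴴ·Q_kᴴ·(A·Q_k·U_{k,1} + B·Q_k·U_{k,2}) + U_{k,2}ᴴ·U_{k,1} = H_k, where H_k is the leading k×k submatrix of H̄. In particular, if H̄ is upper Hessenberg then the matrix U_{k,1}ᴴ·Q_kᴴ·(A·Q_k·U_{k,1} + B·Q_k·U_{k,2}) + U_{k,2}ᴴ·U_{k,1} is upper Hessenberg. -/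
open Matrix

/-- If `V` has orthonormal columns, multiplying `V * H` by the conjugate transpose of a selection
of columns of `V` selects the corresponding rows of `H`. -/
theorem conjTranspose_submatrix_mul_mul_eq_submatrix {R ι κ l p : Type*} [Semiring R] [StarRing R]
    [Fintype ι] [Fintype κ] [DecidableEq κ] (V : Matrix ι κ R) (H : Matrix κ p R) (f : l → κ)
    (hV : Vᴴ * V = 1) :
    (V.submatrix id f)ᴴ * (V * H) = H.submatrix f id := by
  have h : Vᴴ * (V * H) = H := by rw [← Matrix.mul_assoc, hV, Matrix.one_mul]
  ext i j
  exact congrFun (congrFun h (f i)) j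

/-- Under the compact Arnoldi decomposition `L V_k = V_{k+1} H̄` with
`V_{k+1}` having orthonormal columns, `V_k` being its first `k` columns, and `Q_k` having
orthonormal columns, one has
`U_{k,1}ᴴ Q_kᴴ (A Q_k U_{k,1} + B Q_k U_{k,2}) + U_{k,2}ᴴ U_{k,1} = H_k`
(the leading `k×k` block of `H̄`); in particular if `H̄` is upper Hessenberg then so is
this matrix. -/
theorem stmt4 (n m k : ℕ) (A B : Matrix (Fin n) (Fin n) ℂ)
    (Qk : Matrix (Fin n) (Fin m) ℂ)
    (Uk1 Uk2 : Matrix (Fin m) (Fin k) ℂ)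
    (Vk1 : Matrix (Fin n ⊕ Fin n) (Fin k ⊕ Unit) ℂ)
    (Hb : Matrix (Fin k ⊕ Unit) (Fin k) ℂ)
    (hArnoldi :
      Matrix.fromBlocks A B (1 : Matrix (Fin n) (Fin n) ℂ) 0 *
          Matrix.fromRows (Qk * Uk1) (Qk * Uk2) = Vk1 * Hb)
    (hVorth : Vk1ᴴ * Vk1 = 1)
    (hfirst : Vk1.submatrix id Sum.inl = Matrix.fromRows (Qk * Uk1) (Qk * Uk2))
    (hQ : Qkᴴ * Qk = 1) :
    Uk1ᴴ * Qkᴴ * (A * Qk * Uk1 + B * Qk * Uk2) + Uk2ᴴ * Uk1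
        = Hb.submatrix Sum.inl id ∧
    ((∀ (i : Fin k ⊕ Unit) (j : Fin k),
        (j : ℕ) + 1 < Sum.elim (fun a : Fin k => (a : ℕ)) (fun _ => k) i → Hb i j = 0) →
      ∀ i j : Fin k, (j : ℕ) + 1 < (i : ℕ) →
        (Uk1ᴴ * Qkᴴ * (A * Qk * Uk1 + B * Qk * Uk2) + Uk2ᴴ * Uk1) i j = 0) := by
  have hproj : (Matrix.fromRows (Qk * Uk1) (Qk * Uk2))ᴴ * (Vk1 * Hb)
      = Hb.submatrix Sum.inl id := by
    rw [← hfirst]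
    exact conjTranspose_submatrix_mul_mul_eq_submatrix Vk1 Hb Sum.inl hVorth
  have hmain : Uk1ᴴ * Qkᴴ * (A * Qk * Uk1 + B * Qk * Uk2) + Uk2ᴴ * Uk1
      = Hb.submatrix Sum.inl id := by
    have hU : Uk2ᴴ * Qkᴴ * (Qk * Uk1) = Uk2ᴴ * Uk1 := by
      rw [Matrix.mul_assoc, ← Matrix.mul_assoc Qkᴴ, hQ, Matrix.one_mul]
    rw [← hproj, ← hArnoldi, fromBlocks_mul_fromRows,
      conjTranspose_fromRows_eq_fromCols_conjTranspose,
      fromCols_mul_fromRows, Matrix.one_mul, Matrix.zero_mul, add_zero,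
      conjTranspose_mul, conjTranspose_mul, hU, Matrix.mul_assoc A, Matrix.mul_assoc B]
  refine ⟨hmain, fun hH i j hij => ?_⟩
  rw [hmain]
  exact hH (Sum.inl i) j hij
end

section
/- Assume the compact Arnoldi decomposition L·V_k = V_{k+1}·H̄ holds, where V_{k+1} has orthonormal columns (V_{k+1}ᴴ·V_{k+1} = I), Q_{k+1} = [Q_k, q_{k+1}] has orthonormal columns (Q_{k+1}ᴴ·Q_{k+1} = I), U_{k+1,1} = [[U_{k,1}, x_k],[0, β_k]], U_{k+1,2} = [[U_{k,2}, y_k],[0, 0]], and H̄ has leading k×k block H_k and last row h_{k+1,k}·e_kᵀ. If h_{k+1,k} ≠ 0, then U_{k,1}ᴴ·x_k = −U_{k,2}ᴴ·y_k. -/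
open Matrix

/-- Lemma 4 of the paper: Under the compact Arnoldi decomposition
`L V_k = V_{k+1} H̄` with `V_{k+1}` and `Q_{k+1} = [Q_k, q_{k+1}]` both having orthonormal
columns, `U_{k+1,1} = [[U_{k,1}, x_k],[0, β_k]]`, `U_{k+1,2} = [[U_{k,2}, y_k],[0, 0]]`,
and `H̄ = [H_k ; h_{k+1,k} e_kᵀ]` with `h_{k+1,k} ≠ 0`, one has
`U_{k,1}ᴴ x_k = − U_{k,2}ᴴ y_k`.
(The paper's `k` is here `k+1`, so that the last column index is `Fin.last k`.) -/
theorem stmt6 (n m k : ℕ) (A B : Matrix (Fin n) (Fin n) ℂ)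
    (Qk : Matrix (Fin n) (Fin m) ℂ) (qk1 : Fin n → ℂ)
    (Uk1 Uk2 : Matrix (Fin m) (Fin (k + 1)) ℂ)
    (xk yk : Fin m → ℂ) (βk hsub : ℂ)
    (Hk : Matrix (Fin (k + 1)) (Fin (k + 1)) ℂ)
    (Qk1 : Matrix (Fin n) (Fin m ⊕ Unit) ℂ)
    (hQk1 : Qk1 = Matrix.of fun i => Sum.elim (Qk i) fun _ => qk1 i)
    (Uk11 Uk12 : Matrix (Fin m ⊕ Unit) (Fin (k + 1) ⊕ Unit) ℂ)
    (hUk11 : Uk11 = Matrix.fromBlocks Uk1 (Matrix.of fun i (_ : Unit) => xk i) 0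
      (Matrix.of fun (_ : Unit) (_ : Unit) => βk))
    (hUk12 : Uk12 = Matrix.fromBlocks Uk2 (Matrix.of fun i (_ : Unit) => yk i) 0 0)
    (Hb : Matrix (Fin (k + 1) ⊕ Unit) (Fin (k + 1)) ℂ)
    (hHb : Hb = Matrix.fromRows Hk
      (Matrix.of fun (_ : Unit) j => if j = Fin.last k then hsub else 0))
    (hArnoldi :
      Matrix.fromBlocks A B (1 : Matrix (Fin n) (Fin n) ℂ) 0 *
          Matrix.fromRows (Qk * Uk1) (Qk * Uk2)
        = Matrix.fromRows (Qk1 * Uk11) (Qk1 * Uk12) * Hb)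
    (hVorth : (Matrix.fromRows (Qk1 * Uk11) (Qk1 * Uk12))ᴴ *
        Matrix.fromRows (Qk1 * Uk11) (Qk1 * Uk12) = 1)
    (hQorth : Qk1ᴴ * Qk1 = 1)
    (hne : hsub ≠ 0) :
    Uk1ᴴ *ᵥ xk = -(Uk2ᴴ *ᵥ yk) := by
  have hU : Uk11ᴴ * Uk11 + Uk12ᴴ * Uk12 = 1 := by
    rw [conjTranspose_fromRows_eq_fromCols_conjTranspose, fromCols_mul_fromRows,
      conjTranspose_mul, conjTranspose_mul, Matrix.mul_assoc, Matrix.mul_assoc,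
      ← Matrix.mul_assoc Qk1ᴴ, ← Matrix.mul_assoc Qk1ᴴ, hQorth, Matrix.one_mul,
      Matrix.one_mul] at hVorth
    exact hVorth
  rw [hUk11, hUk12, fromBlocks_conjTranspose, fromBlocks_conjTranspose, fromBlocks_multiply,
    fromBlocks_multiply, fromBlocks_add, ← fromBlocks_one, fromBlocks_inj] at hU
  ext j
  have h := congrFun (congrFun hU.2.1 j) ()
  simp only [conjTranspose_zero, Matrix.zero_mul, add_zero] at h
  exact eq_neg_of_add_eq_zero_left h
end

section
/- Assume the compact Arnoldi decomposition L·V_k = V_{k+1}·H̄ holds, where Q_{k+1} = [Q_k, q_{k+1}] has orthonormal columns (Q_{k+1}ᴴ·Q_{k+1} = I), U_{k+1,1} = [[U_{k,1}, x_k],[0, β_k]], U_{k+1,2} = [[U_{k,2}, y_k],[0, 0]], and H̄ has leading k×k block H_k and last row h_{k+1,k}·e_kᵀ. Assume further that: (i) A and B are Hermitian (Aᴴ = A and Bᴴ = B); (ii) the last column of U_{k+1,1} is orthogonal to the previous ones, i.e. U_{k,1}ᴴ·x_k = 0; (iii) the appended column of Q_{k+1}·U_{k+1,2} is B-orthogonal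 to the columns of Q_k·U_{k,2}, i.e. y_kᴴ·Q_kᴴ·B·Q_k·U_{k,2} = 0; and (iv) U_{k,1}ᴴ·U_{k,1} + U_{k,2}ᴴ·Q_kᴴ·B·Q_k·U_{k,2} = I. Then H_k is Hermitian, i.e. H_kᴴ = H_k. -/
open Matrix

/-- Multiplying the first block row of a compact Arnoldi relation by `W₁ᴴ` and the second one by
`W₂ᴴ * B`, and adding, exhibits the projected matrix `H` as a Hermitian matrix. -/
theorem isHermitian_of_compact_arnoldi {ι κ τ R : Type*} [Fintype ι] [Fintype κ] [DecidableEq κ]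
    [Fintype τ] [Ring R] [StarRing R] {A B : Matrix ι ι R} {W₁ W₂ : Matrix ι κ R}
    {w₁ w₂ : Matrix ι τ R} {r : Matrix τ κ R} {H : Matrix κ κ R}
    (h₁ : A * W₁ + B * W₂ = W₁ * H + w₁ * r) (h₂ : W₁ = W₂ * H + w₂ * r)
    (hA : A.IsHermitian) (hB : B.IsHermitian)
    (hw₁ : W₁ᴴ * w₁ = 0) (hw₂ : W₂ᴴ * B * w₂ = 0)
    (hI : W₁ᴴ * W₁ + W₂ᴴ * B * W₂ = 1) : H.IsHermitian := by
  have e₁ : W₁ᴴ * (A * W₁ + B * W₂) = W₁ᴴ * W₁ * H := by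
    rw [h₁, Matrix.mul_add, ← Matrix.mul_assoc, ← Matrix.mul_assoc, hw₁, Matrix.zero_mul, add_zero]
  have e₂ : W₂ᴴ * B * W₁ = W₂ᴴ * B * W₂ * H := by
    conv_lhs => rw [h₂]
    rw [Matrix.mul_add, ← Matrix.mul_assoc, ← Matrix.mul_assoc, hw₂, Matrix.zero_mul, add_zero]
  have hH : H = W₁ᴴ * (A * W₁ + B * W₂) + W₂ᴴ * B * W₁ := by
    rw [e₁, e₂, ← Matrix.add_mul, hI, Matrix.one_mul]
  rw [hH, Matrix.IsHermitian]
  simp only [conjTranspose_add, conjTranspose_mul, conjTranspose_conjTranspose, hA.eq, hB.eq,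
    Matrix.mul_add, Matrix.mul_assoc]
  abel

/-- Lemma 5 of the paper: Under the compact Arnoldi decomposition
`L V_k = V_{k+1} H̄` with `Q_{k+1} = [Q_k, q_{k+1}]` having orthonormal columns,
`U_{k+1,1} = [[U_{k,1}, x_k],[0, β_k]]`, `U_{k+1,2} = [[U_{k,2}, y_k],[0, 0]]`,
`H̄ = [H_k ; h_{k+1,k} e_kᵀ]`; if moreover (i) `A` and `B` are Hermitian,
(ii) `U_{k,1}ᴴ x_k = 0`, (iii) `y_kᴴ Q_kᴴ B Q_k U_{k,2} = 0`, and
(iv) `U_{k,1}ᴴ U_{k,1} + U_{k,2}ᴴ Q_kᴴ B Q_k U_{k,2} = I`, then `H_k` is Hermitian.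
(The paper's `k` is here `k+1`, so that the last column index is `Fin.last k`.) -/
theorem stmt7 (n m k : ℕ) (A B : Matrix (Fin n) (Fin n) ℂ)
    (Qk : Matrix (Fin n) (Fin m) ℂ) (qk1 : Fin n → ℂ)
    (Uk1 Uk2 : Matrix (Fin m) (Fin (k + 1)) ℂ)
    (xk yk : Fin m → ℂ) (βk hsub : ℂ)
    (Hk : Matrix (Fin (k + 1)) (Fin (k + 1)) ℂ)
    (Qk1 : Matrix (Fin n) (Fin m ⊕ Unit) ℂ)
    (hQk1 : Qk1 = Matrix.of fun i => Sum.elim (Qk i) fun _ => qk1 i)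
    (Uk11 Uk12 : Matrix (Fin m ⊕ Unit) (Fin (k + 1) ⊕ Unit) ℂ)
    (hUk11 : Uk11 = Matrix.fromBlocks Uk1 (Matrix.of fun i (_ : Unit) => xk i) 0
      (Matrix.of fun (_ : Unit) (_ : Unit) => βk))
    (hUk12 : Uk12 = Matrix.fromBlocks Uk2 (Matrix.of fun i (_ : Unit) => yk i) 0 0)
    (Hb : Matrix (Fin (k + 1) ⊕ Unit) (Fin (k + 1)) ℂ)
    (hHb : Hb = Matrix.fromRows Hk
      (Matrix.of fun (_ : Unit) j => if j = Fin.last k then hsub else 0))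
    (hArnoldi :
      Matrix.fromBlocks A B (1 : Matrix (Fin n) (Fin n) ℂ) 0 *
          Matrix.fromRows (Qk * Uk1) (Qk * Uk2)
        = Matrix.fromRows (Qk1 * Uk11) (Qk1 * Uk12) * Hb)
    (hQorth : Qk1ᴴ * Qk1 = 1)
    (hA : Aᴴ = A) (hB : Bᴴ = B)
    (hx : Uk1ᴴ *ᵥ xk = 0)
    (hy : (star yk) ᵥ* (Qkᴴ * B * Qk * Uk2) = 0)
    (hI : Uk1ᴴ * Uk1 + Uk2ᴴ * Qkᴴ * B * Qk * Uk2 = 1) :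
    Hkᴴ = Hk := by
  set q : Matrix (Fin n) Unit ℂ := Matrix.of fun i _ => qk1 i
  set x : Matrix (Fin m) Unit ℂ := Matrix.of fun i _ => xk i
  set y : Matrix (Fin m) Unit ℂ := Matrix.of fun i _ => yk i
  set b : Matrix Unit Unit ℂ := Matrix.of fun _ _ => βk
  set r : Matrix Unit (Fin (k + 1)) ℂ := Matrix.of fun _ j => if j = Fin.last k then hsub else 0
  have hQ : Qk1 = Matrix.fromCols Qk q := by
    rw [hQk1]
    ext i (j | j) <;> rfl
  have hx' : Uk1ᴴ * x = 0 := by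
    ext i j
    exact congrFun hx i
  have hy' : yᴴ * (Qkᴴ * B * Qk * Uk2) = 0 := by
    ext i j
    exact congrFun hy j
  rw [hQ, conjTranspose_fromCols_eq_fromRows_conjTranspose, fromRows_mul_fromCols,
    ← fromBlocks_one, fromBlocks_inj] at hQorth
  obtain ⟨hQQ, hQq, -, -⟩ := hQorth
  rw [hQ, hUk11, hUk12, hHb, fromBlocks_mul_fromRows, fromRows_mul, fromCols_mul_fromBlocks,
    fromCols_mul_fromBlocks, fromCols_mul_fromRows, fromCols_mul_fromRows] at hArnoldi
  obtain ⟨h₁, h₂⟩ := fromRows_inj hArnoldi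
  simp only [Matrix.mul_zero, Matrix.one_mul, Matrix.zero_mul, add_zero] at h₁ h₂
  refine (isHermitian_of_compact_arnoldi h₁ h₂ hA hB ?_ ?_ ?_).eq
  · rw [conjTranspose_mul, Matrix.mul_add, Matrix.mul_assoc, ← Matrix.mul_assoc Qkᴴ, hQQ,
      Matrix.one_mul, hx', Matrix.mul_assoc, ← Matrix.mul_assoc Qkᴴ, hQq]
    simp
  · have h := congrArg conjTranspose hy'
    simpa only [conjTranspose_mul, conjTranspose_conjTranspose, conjTranspose_zero, hB,
      Matrix.mul_assoc] using h
  · rw [← hI, conjTranspose_mul, conjTranspose_mul, Matrix.mul_assoc Uk1ᴴ, ← Matrix.mul_assoc Qkᴴ, hQQ,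
      Matrix.one_mul]
    simp only [Matrix.mul_assoc]
end

section
/- Assume the compact Arnoldi decomposition L·V_k = V_{k+1}·H̄ holds, where V_{k+1} has orthonormal columns (V_{k+1}ᴴ·V_{k+1} = I), Q_{k+1} = [Q_k, q_{k+1}] has orthonormal columns (Q_{k+1}ᴴ·Q_{k+1} = I), U_{k+1,1} = [[U_{k,1}, x_k],[0, β_k]], U_{k+1,2} = [[U_{k,2}, y_k],[0, 0]], H̄ has leading k×k block H_k and last row h_{k+1,k}·e_kᵀ, and h_{k+1,k} ≠ 0. If the columns of U_{k+1,1} are pairwise orthogonal (U_{k+1,1}ᴴ·U_{k+1,1} is a diagonal matrix), then: (i) U_{k,2}ᴴ·y_k = 0; (ii) U_{k,2}ᴴ·U_{k,1} = (U_{k,2}ᴴ·U_{k,2})·H_k; and (iii) U_{k,2}ᴴ·U_{k,2} is a diagonal matrix. -/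
open Matrix

/-- Lemma 7 of the paper: Under the compact Arnoldi decomposition
`L V_k = V_{k+1} H̄` with `V_{k+1}` and `Q_{k+1} = [Q_k, q_{k+1}]` having orthonormal
columns, `U_{k+1,1} = [[U_{k,1}, x_k],[0, β_k]]`, `U_{k+1,2} = [[U_{k,2}, y_k],[0, 0]]`,
`H̄ = [H_k ; h_{k+1,k} e_kᵀ]`, `h_{k+1,k} ≠ 0`, if the columns of `U_{k+1,1}` are pairwise
orthogonal (`U_{k+1,1}ᴴ U_{k+1,1}` diagonal), then (i) `U_{k,2}ᴴ y_k = 0`,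
(ii) `U_{k,2}ᴴ U_{k,1} = (U_{k,2}ᴴ U_{k,2}) H_k`, and (iii) `U_{k,2}ᴴ U_{k,2}` is diagonal.
(The paper's `k` is here `k+1`, so that the last column index is `Fin.last k`.) -/
theorem stmt8 (n m k : ℕ) (A B : Matrix (Fin n) (Fin n) ℂ)
    (Qk : Matrix (Fin n) (Fin m) ℂ) (qk1 : Fin n → ℂ)
    (Uk1 Uk2 : Matrix (Fin m) (Fin (k + 1)) ℂ)
    (xk yk : Fin m → ℂ) (βk hsub : ℂ)
    (Hk : Matrix (Fin (k + 1)) (Fin (k + 1)) ℂ)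
    (Qk1 : Matrix (Fin n) (Fin m ⊕ Unit) ℂ)
    (hQk1 : Qk1 = Matrix.of fun i => Sum.elim (Qk i) fun _ => qk1 i)
    (Uk11 Uk12 : Matrix (Fin m ⊕ Unit) (Fin (k + 1) ⊕ Unit) ℂ)
    (hUk11 : Uk11 = Matrix.fromBlocks Uk1 (Matrix.of fun i (_ : Unit) => xk i) 0
      (Matrix.of fun (_ : Unit) (_ : Unit) => βk))
    (hUk12 : Uk12 = Matrix.fromBlocks Uk2 (Matrix.of fun i (_ : Unit) => yk i) 0 0)
    (Hb : Matrix (Fin (k + 1) ⊕ Unit) (Fin (k + 1)) ℂ)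
    (hHb : Hb = Matrix.fromRows Hk
      (Matrix.of fun (_ : Unit) j => if j = Fin.last k then hsub else 0))
    (hArnoldi :
      Matrix.fromBlocks A B (1 : Matrix (Fin n) (Fin n) ℂ) 0 *
          Matrix.fromRows (Qk * Uk1) (Qk * Uk2)
        = Matrix.fromRows (Qk1 * Uk11) (Qk1 * Uk12) * Hb)
    (hVorth : (Matrix.fromRows (Qk1 * Uk11) (Qk1 * Uk12))ᴴ *
        Matrix.fromRows (Qk1 * Uk11) (Qk1 * Uk12) = 1)
    (hQorth : Qk1ᴴ * Qk1 = 1)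
    (hne : hsub ≠ 0)
    (hdiag : (Uk11ᴴ * Uk11).IsDiag) :
    Uk2ᴴ *ᵥ yk = 0 ∧
      Uk2ᴴ * Uk1 = (Uk2ᴴ * Uk2) * Hk ∧
      (Uk2ᴴ * Uk2).IsDiag := by
  have hgram : Uk11ᴴ * Uk11 + Uk12ᴴ * Uk12 = 1 := by
    have hU (U : Matrix (Fin m ⊕ Unit) (Fin (k + 1) ⊕ Unit) ℂ) :
        (Qk1 * U)ᴴ * (Qk1 * U) = Uᴴ * U := by
      rw [conjTranspose_mul, Matrix.mul_assoc, ← Matrix.mul_assoc Qk1ᴴ, hQorth, Matrix.one_mul]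
    rw [← hVorth, conjTranspose_fromRows_eq_fromCols_conjTranspose, fromCols_mul_fromRows, hU, hU]
  have hdiag₂ : (Uk12ᴴ * Uk12).IsDiag := by
    rw [eq_sub_of_add_eq' hgram]
    exact isDiag_one.sub hdiag
  have hblocks : Uk12ᴴ * Uk12 = fromBlocks (Uk2ᴴ * Uk2) (Uk2ᴴ * of fun i (_ : Unit) => yk i)
      ((of fun i (_ : Unit) => yk i)ᴴ * Uk2)
      ((of fun i (_ : Unit) => yk i)ᴴ * of fun i (_ : Unit) => yk i) := by
    rw [hUk12, fromBlocks_conjTranspose, fromBlocks_multiply]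
    simp
  rw [hblocks] at hdiag₂
  have horth : (Uk2ᴴ * of fun i (_ : Unit) => yk i) = 0 := by
    ext i j
    exact hdiag₂ (i := Sum.inl i) (j := Sum.inr j) (by simp)
  have hQ : Qk1 = fromCols Qk (of fun i (_ : Unit) => qk1 i) := by
    rw [hQk1]
    ext i (j | j) <;> rfl
  have hQk : Qkᴴ * Qk = 1 := by
    rw [hQ, conjTranspose_fromCols_eq_fromRows_conjTranspose, fromRows_mul_fromCols,
      ← fromBlocks_one] at hQorth
    exact (fromBlocks_inj.mp hQorth).1
  have hUk1 : Uk1 = Uk2 * Hk + (of fun i (_ : Unit) => yk i) *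
      (of fun (_ : Unit) j => if j = Fin.last k then hsub else 0) := by
    rw [fromBlocks_mul_fromRows, fromRows_mul] at hArnoldi
    have h := (fromRows_inj hArnoldi).2
    rw [Matrix.one_mul, Matrix.zero_mul, add_zero, Matrix.mul_assoc, hHb, hUk12,
      fromBlocks_mul_fromRows, hQ, fromCols_mul_fromRows] at h
    simp only [Matrix.zero_mul, add_zero, Matrix.mul_zero] at h
    simpa only [← Matrix.mul_assoc, hQk, Matrix.one_mul] using congrArg (Qkᴴ * ·) h
  refine ⟨?_, ?_, ?_⟩
  · ext i
    exact congrFun (congrFun horth i) ()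
  · rw [hUk1, Matrix.mul_add, ← Matrix.mul_assoc, ← Matrix.mul_assoc, horth, Matrix.zero_mul,
      add_zero]
  · intro i j hij
    exact hdiag₂ (i := Sum.inl i) (j := Sum.inl j) (by simpa using hij)
end
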